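/- Suppose the local transition matrix T of the PCA on the N-cycle is irreducible. The system achieves synchronization (i.e., with probability one, there is a finite time t_0 such that X_1(t) = ... = X_N(t) for all t ≥ t_0) if and only if T is periodic with period K. -/

import Mathlib

open Matrix Finset MeasureTheory

/-- A row-stochastic matrix: nonnegative entries, each row sums to 1. -/
def RowStochastic {S : Type*} [Fintype S] (T : Matrix S S ℝ) : Prop :=
  (∀ j k, 0 ≤ T j k) ∧ ∀ j, ∑ k, T j k = 1

/-- Irreducibility of a nonnegative matrix: every state reaches every state. -/
def MatIrreducible {S : Type*} [Fintype S] [DecidableEq S] (T : Matrix S S ℝ) : Prop :=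
  ∀ i j, ∃ t : ℕ, 0 < (T ^ t) i j

/-- `d` is the period of state `i`: the gcd of the set of positive return times. -/
def IsGcdPeriod {S : Type*} [Fintype S] [DecidableEq S] (T : Matrix S S ℝ) (i : S) (d : ℕ) : Prop :=
  (∀ m : ℕ, 0 < m → 0 < (T ^ m) i i → d ∣ m) ∧
    ∀ e : ℕ, (∀ m : ℕ, 0 < m → 0 < (T ^ m) i i → e ∣ m) → e ∣ d

/-- The neighborhood of node `n` on the `N`-cycle: all nodes within cyclic distance `nv`. -/
def nbhd (N nv : ℕ) (n : Fin N) : Finset (Fin N) :=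
  Finset.univ.filter fun i => (n.val + N - i.val) % N ≤ nv ∨ (i.val + N - n.val) % N ≤ nv

/-- The PCA global transition matrix on configurations. -/
noncomputable def pcaP (N K nv : ℕ) (T : Matrix (Fin K) (Fin K) ℝ) :
    Matrix (Fin N → Fin K) (Fin N → Fin K) ℝ :=
  Matrix.of fun x y =>
    ∏ n : Fin N, (((nbhd N nv n).card : ℝ)⁻¹ * ∑ i ∈ nbhd N nv n, T (x i) (y n))

/-- Cyclic class decomposition of `[K]` for `T` with period `d`. -/
def CyclicClasses {K : ℕ} (T : Matrix (Fin K) (Fin K) ℝ) (d : ℕ)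
    (C : ℕ → Finset (Fin K)) : Prop :=
  (∀ r, C (r + d) = C r) ∧ (∀ k : Fin K, ∃! r : ℕ, r < d ∧ k ∈ C r) ∧
    ∀ j k, 0 < T j k → ∃ r, j ∈ C r ∧ k ∈ C (r + 1)

/-- A probability law of a PCA trajectory: a measure on path space whose cylinder
probabilities satisfy the Markov recursion with one-step transition matrix `P`. -/
def IsPCATrajectory {K N : ℕ} (μ : Measure (ℕ → Fin N → Fin K))
    (P : Matrix (Fin N → Fin K) (Fin N → Fin K) ℝ) : Prop :=
  ∀ (t : ℕ) (f : ℕ → Fin N → Fin K),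
    (μ {ω | ∀ s ≤ t + 1, ω s = f s}).toReal
      = (μ {ω | ∀ s ≤ t, ω s = f s}).toReal * P (f t) (f (t + 1))

section Markov

variable {S : Type*} [Fintype S] [DecidableEq S] [MeasurableSpace S] [MeasurableSingletonClass S]

/-- Markov recursion for cylinder probabilities, generic state space. -/
def GenTraj (μ : Measure (ℕ → S)) (P : Matrix S S ℝ) : Prop :=
  ∀ (t : ℕ) (f : ℕ → S),
    (μ {ω | ∀ s ≤ t + 1, ω s = f s}).toReal
      = (μ {ω | ∀ s ≤ t, ω s = f s}).toReal * P (f t) (f (t + 1))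

lemma real_fibers {Ω G : Type*} [MeasurableSpace Ω] [Fintype G] [MeasurableSpace G]
    [MeasurableSingletonClass G]
    (μ : Measure Ω) [IsProbabilityMeasure μ] (r : Ω → G) (hr : Measurable r) (A : Set Ω) :
    (μ A).toReal = ∑ g, (μ (r ⁻¹' {g} ∩ A)).toReal := by
  have h := sum_measure_preimage_singleton (μ := μ.restrict A) (f := r) Finset.univ
    (fun y _ => hr (measurableSet_singleton y))
  simp only [Finset.coe_univ, Set.preimage_univ, Measure.restrict_apply_univ] at h
  rw [← h, ENNReal.toReal_sum (fun a _ => measure_ne_top _ _)]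
  refine Finset.sum_congr rfl fun g _ => ?_
  rw [Measure.restrict_apply (hr (measurableSet_singleton g))]

lemma markov_step (μ : Measure (ℕ → S)) [IsProbabilityMeasure μ] (P : Matrix S S ℝ)
    (h : GenTraj μ P) (t : ℕ) (D : Set (ℕ → S))
    (hD : ∀ ω ω' : ℕ → S, (∀ s ≤ t, ω s = ω' s) → ω ∈ D → ω' ∈ D) (x y : S) :
    (μ {ω | ω ∈ D ∧ ω t = x ∧ ω (t + 1) = y}).toReal
      = (μ {ω | ω ∈ D ∧ ω t = x}).toReal * P x y := by
  let r : (ℕ → S) → (Fin (t + 1) → S) := fun ω s => ω s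
  have hr : Measurable r := measurable_pi_lambda _ fun s => measurable_pi_apply _
  rw [real_fibers μ r hr, real_fibers μ r hr {ω | ω ∈ D ∧ ω t = x}, Finset.sum_mul]
  refine Finset.sum_congr rfl fun g _ => ?_
  let f : ℕ → S := fun s => if h : s < t + 1 then g ⟨s, h⟩ else y
  have hf1 : f (t + 1) = y := by simp [f]
  have hrg : ∀ ω, r ω = g ↔ ∀ s ≤ t, ω s = f s := by
    intro ω
    constructor
    · intro e s hs
      have : s < t + 1 := by omega
      simp only [f, dif_pos this, ← e, r]
    · intro e
      funext s
      have h2 := s.2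
      have := e s (by omega)
      simp only [f, dif_pos h2] at this
      exact this
  by_cases hc : f ∈ D ∧ f t = x
  · have e1 : r ⁻¹' {g} ∩ {ω | ω ∈ D ∧ ω t = x ∧ ω (t + 1) = y}
        = {ω | ∀ s ≤ t + 1, ω s = f s} := by
      ext ω
      simp only [Set.mem_inter_iff, Set.mem_preimage, Set.mem_singleton_iff, hrg, Set.mem_ofPred_eq]
      constructor
      · rintro ⟨a, _, _, b⟩ s hs
        rcases Nat.lt_or_ge t s with h1 | h1
        · obtain rfl : s = t + 1 := by omega
          rw [b, hf1]
        · exact a s h1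
      · intro a
        have a' : ∀ s ≤ t, ω s = f s := fun s hs => a s (by omega)
        exact ⟨a', hD f ω (fun s hs => (a' s hs).symm) hc.1, (a' t le_rfl).trans hc.2,
          (a _ le_rfl).trans hf1⟩
    have e2 : r ⁻¹' {g} ∩ {ω | ω ∈ D ∧ ω t = x}
        = {ω | ∀ s ≤ t, ω s = f s} := by
      ext ω
      simp only [Set.mem_inter_iff, Set.mem_preimage, Set.mem_singleton_iff, hrg, Set.mem_ofPred_eq]
      constructor
      · rintro ⟨a, _, _⟩
        exact a
      · intro a'
        exact ⟨a', hD f ω (fun s hs => (a' s hs).symm) hc.1, (a' t le_rfl).trans hc.2⟩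
    rw [e1, e2, h t f, hf1, hc.2]
  · have key : ∀ ω, r ω = g → ¬ (ω ∈ D ∧ ω t = x) := by
      intro ω e ⟨d, e'⟩
      rw [hrg] at e
      exact hc ⟨hD ω f e d, (e t le_rfl).symm.trans e'⟩
    have e1 : r ⁻¹' {g} ∩ {ω | ω ∈ D ∧ ω t = x ∧ ω (t + 1) = y} = ∅ := by
      ext ω
      simp only [Set.mem_inter_iff, Set.mem_preimage, Set.mem_singleton_iff, Set.mem_ofPred_eq,
        Set.mem_empty_iff_false, iff_false]
      rintro ⟨a, b, c, _⟩
      exact key ω a ⟨b, c⟩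
    have e2 : r ⁻¹' {g} ∩ {ω | ω ∈ D ∧ ω t = x} = ∅ := by
      ext ω
      simp only [Set.mem_inter_iff, Set.mem_preimage, Set.mem_singleton_iff, Set.mem_ofPred_eq,
        Set.mem_empty_iff_false, iff_false]
      rintro ⟨a, b, c⟩
      exact key ω a ⟨b, c⟩
    rw [e1, e2]
    simp

lemma ae_pos (μ : Measure (ℕ → S)) [IsProbabilityMeasure μ] (P : Matrix S S ℝ)
    (h : GenTraj μ P) : ∀ᵐ ω ∂μ, ∀ t, P (ω t) (ω (t + 1)) ≠ 0 := by
  have : ∀ᵐ ω ∂μ, ∀ t x y, P x y = 0 → ¬ (ω t = x ∧ ω (t + 1) = y) := by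
    simp only [ae_all_iff]
    intro t x y hP
    have := markov_step μ P h t Set.univ (by simp) x y
    rw [hP, mul_zero, ENNReal.toReal_eq_zero_iff] at this
    rcases this with h1 | h1
    · rw [ae_iff]
      simpa using h1
    · exact absurd h1 (measure_ne_top _ _)
  filter_upwards [this] with ω hω t h0
  exact hω t _ _ h0 ⟨rfl, rfl⟩

/-- probability of staying in `B` for `n` steps -/
noncomputable def stay (P : Matrix S S ℝ) (B : Finset S) : ℕ → S → ℝ
  | 0 => fun x => if x ∈ B then 1 else 0
  | n + 1 => fun x => if x ∈ B then ∑ y, P x y * stay P B n y else 0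

lemma stay_tendsto (P : Matrix S S ℝ) (hP : RowStochastic P) (B : Finset S)
    (hB : ∀ x ∈ B, ∃ y, y ∉ B ∧ Relation.ReflTransGen (fun a b => 0 < P a b) x y) (x : S) :
    Filter.Tendsto (fun n => stay P B n x) Filter.atTop (nhds 0) := by
  have h0 : ∀ n x, 0 ≤ stay P B n x := by
    intro n
    induction n with
    | zero => intro x; simp only [stay]; split_ifs <;> norm_num
    | succ n ih =>
      intro x; simp only [stay]; split_ifs
      · exact Finset.sum_nonneg fun y _ => mul_nonneg (hP.1 _ _) (ih y)
      · exact le_rfl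
  have hs : ∀ n x, stay P B (n + 1) x ≤ stay P B n x := by
    intro n
    induction n with
    | zero =>
      intro x; simp only [stay]; split_ifs
      · refine le_trans ?_ (hP.2 x).le
        refine Finset.sum_le_sum fun y _ => ?_
        split_ifs
        · exact (mul_one _).le
        · exact (mul_zero _).trans_le (hP.1 x y)
      · exact le_rfl
    | succ n ih =>
      intro x
      have e : ∀ m, stay P B (m + 1) x = if x ∈ B then ∑ y, P x y * stay P B m y else 0 :=
        fun m => rfl
      rw [e, e]
      split_ifs
      · exact Finset.sum_le_sum fun y _ => mul_le_mul_of_nonneg_left (ih y) (hP.1 _ _)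
      · exact le_rfl
  have hanti : ∀ x, Antitone fun n => stay P B n x := fun x =>
    antitone_nat_of_succ_le fun n => hs n x
  have hlim : ∀ x, ∃ l, Filter.Tendsto (fun n => stay P B n x) Filter.atTop (nhds l) := fun x =>
    ⟨_, tendsto_atTop_ciInf (hanti x) ⟨0, by rintro _ ⟨n, rfl⟩; exact h0 n x⟩⟩
  choose u hu using hlim
  have hu0 : ∀ x, 0 ≤ u x := fun x => ge_of_tendsto' (hu x) fun n => h0 n x
  have hueq : ∀ x ∈ B, u x = ∑ y, P x y * u y := by
    intro x hx
    have h1 := (hu x).comp (Filter.tendsto_add_atTop_nat 1)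
    have h2 : Filter.Tendsto (fun n => ∑ y, P x y * stay P B n y) Filter.atTop
        (nhds (∑ y, P x y * u y)) := tendsto_finsetSum _ fun y _ => (hu y).const_mul _
    refine tendsto_nhds_unique h1 (h2.congr fun n => ?_)
    simp [stay, hx]
  have huB : ∀ x, x ∉ B → u x = 0 := by
    intro x hx
    refine tendsto_nhds_unique (hu x) (tendsto_const_nhds.congr fun n => ?_)
    cases n <;> simp [stay, hx]
  obtain ⟨m, -, hm⟩ := Finset.exists_max_image Finset.univ u ⟨x, Finset.mem_univ x⟩
  have hm0 : u m = 0 := by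
    by_contra hne
    have hpos : 0 < u m := lt_of_le_of_ne (hu0 m) (Ne.symm hne)
    have hmB : m ∈ B := by
      by_contra hb
      exact hne (huB m hb)
    obtain ⟨y, hy, hr⟩ := hB m hmB
    have : u y = u m := by
      clear hy
      induction hr with
      | refl => rfl
      | @tail b c _ hbc ih =>
        have hbB : b ∈ B := by
          by_contra hb
          rw [huB b hb] at ih
          exact hne ih.symm
        have e1 := hueq b hbB
        have e2 : ∑ y, P b y * (u m - u y) = 0 := by
          simp only [mul_sub, Finset.sum_sub_distrib]
          rw [← Finset.sum_mul, hP.2, ← e1, ih]; ring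
        rw [Finset.sum_eq_zero_iff_of_nonneg (fun y _ =>
          mul_nonneg (hP.1 _ _) (sub_nonneg.2 (hm y (Finset.mem_univ y))))] at e2
        have := e2 c (Finset.mem_univ c)
        rcases mul_eq_zero.1 this with h3 | h3
        · exact absurd h3 hbc.ne'
        · linarith
    rw [huB y hy] at this
    exact hne this.symm
  have : u x = 0 := le_antisymm (hm0 ▸ hm x (Finset.mem_univ x)) (hu0 x)
  exact this ▸ hu x

lemma escape (μ : Measure (ℕ → S)) [IsProbabilityMeasure μ] (P : Matrix S S ℝ)
    (h : GenTraj μ P) (hP : RowStochastic P) (B : Finset S)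
    (hB : ∀ x ∈ B, ∃ y, y ∉ B ∧ Relation.ReflTransGen (fun a b => 0 < P a b) x y) :
    ∀ᵐ ω ∂μ, ∀ t₀ : ℕ, ∃ t ≥ t₀, ω t ∉ B := by
  rw [ae_all_iff]
  intro t₀
  let D : ℕ → Set (ℕ → S) := fun t => {ω | ∀ s ≤ t, t₀ ≤ s → ω s ∈ B}
  let E : ℕ → S → ℝ := fun t x => (μ {ω | ω ∈ D t ∧ ω t = x}).toReal
  have hE : ∀ t, t₀ ≤ t → ∀ y, E (t + 1) y = if y ∈ B then ∑ x, E t x * P x y else 0 := by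
    intro t ht y
    split_ifs with hy
    · simp only [E]
      rw [real_fibers μ (fun ω => ω t) (measurable_pi_apply t)]
      refine Finset.sum_congr rfl fun x _ => ?_
      rw [← markov_step μ P h t (D t)
        (fun ω ω' he hω s hs hs' => he s hs ▸ hω s hs hs') x y]
      congr 2
      ext ω
      simp only [D, Set.mem_inter_iff, Set.mem_preimage, Set.mem_singleton_iff, Set.mem_ofPred_eq]
      constructor
      · rintro ⟨a, b, c⟩
        exact ⟨fun s hs => b s (by omega), a, c⟩
      · rintro ⟨a, b, c⟩
        refine ⟨b, fun s hs hs' => ?_, c⟩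
        rcases Nat.lt_or_ge t s with h1 | h1
        · obtain rfl : s = t + 1 := by omega
          rw [c]; exact hy
        · exact a s h1 hs'
    · have : {ω | ω ∈ D (t + 1) ∧ ω (t + 1) = y} = ∅ := by
        ext ω
        simp only [D, Set.mem_ofPred_eq, Set.mem_empty_iff_false, iff_false]
        rintro ⟨a, b⟩
        exact hy (b ▸ a (t + 1) le_rfl (by omega))
      simp only [E, this]; simp
  have hstay : ∀ n x, x ∉ B → stay P B n x = 0 := by
    intro n x hx
    cases n <;> simp [stay, hx]
  have hE0 : ∀ t, t₀ ≤ t → ∀ x, x ∉ B → E t x = 0 := by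
    intro t ht y hy
    have : {ω | ω ∈ D t ∧ ω t = y} = ∅ := by
      ext ω
      simp only [D, Set.mem_ofPred_eq, Set.mem_empty_iff_false, iff_false]
      rintro ⟨a, b⟩
      exact hy (b ▸ a t le_rfl ht)
    simp only [E, this]; simp
  have hinv : ∀ n k, ∑ x, E (t₀ + n) x * stay P B k x = ∑ x, E t₀ x * stay P B (n + k) x := by
    intro n
    induction n with
    | zero => intro k; simp
    | succ n ih =>
      intro k
      have := ih (k + 1)
      rw [show n + 1 + k = n + (k + 1) by ring, ← this, ← add_assoc]
      have e1 : ∀ y, E (t₀ + n + 1) y * stay P B k y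
          = ∑ x, E (t₀ + n) x * (P x y * stay P B k y) := by
        intro y
        rw [hE _ (by omega)]
        split_ifs with hy
        · rw [Finset.sum_mul]
          exact Finset.sum_congr rfl fun x _ => by ring
        · simp [hstay k y hy]
      simp only [e1]
      rw [Finset.sum_comm]
      refine Finset.sum_congr rfl fun x _ => ?_
      rw [← Finset.mul_sum]
      by_cases hx : x ∈ B
      · simp [stay, hx]
      · simp [hE0 _ (by omega : t₀ ≤ t₀ + n) x hx]
  have hlim : Filter.Tendsto (fun n => ∑ x, E t₀ x * stay P B n x) Filter.atTop (nhds 0) := by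
    have := tendsto_finsetSum (f := fun x n => E t₀ x * stay P B n x) (x := Filter.atTop)
      (a := fun x => E t₀ x * 0) Finset.univ
      (fun x _ => (stay_tendsto P hP B hB x).const_mul (E t₀ x))
    simpa using this
  have hle : ∀ n, (μ {ω | ∀ t ≥ t₀, ω t ∈ B}).toReal ≤ ∑ x, E t₀ x * stay P B n x := by
    intro n
    have e := hinv n 0
    rw [add_zero] at e
    rw [← e]
    have e3 : ∑ x, E (t₀ + n) x * stay P B 0 x = ∑ x, E (t₀ + n) x := by
      refine Finset.sum_congr rfl fun x _ => ?_
      by_cases hx : x ∈ B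
      · simp [stay, hx]
      · simp [hE0 _ (by omega : t₀ ≤ t₀ + n) x hx]
    rw [e3]
    have e4 := real_fibers μ (fun ω : ℕ → S => ω (t₀ + n)) (measurable_pi_apply _) (D (t₀ + n))
    have e5 : ∑ x, E (t₀ + n) x = (μ (D (t₀ + n))).toReal := by
      rw [e4]
      refine Finset.sum_congr rfl fun x _ => ?_
      simp only [E]
      congr 2
      ext ω
      simp [and_comm]
    rw [e5]
    refine ENNReal.toReal_mono (measure_ne_top _ _) (measure_mono fun ω hω s _ hs => hω s hs)
  have hz : (μ {ω | ∀ t ≥ t₀, ω t ∈ B}).toReal = 0 :=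
    le_antisymm (ge_of_tendsto' hlim hle) ENNReal.toReal_nonneg
  rw [ENNReal.toReal_eq_zero_iff] at hz
  rcases hz with h1 | h1
  · rw [ae_iff]
    simpa using h1
  · exact absurd h1 (measure_ne_top _ _)

end Markov

section Existence

variable {S : Type*} [Fintype S] [DecidableEq S] [MeasurableSpace S] [MeasurableSingletonClass S]

/-- one-step law -/
noncomputable def stepLaw (P : Matrix S S ℝ) (x : S) : Measure S :=
  ∑ y, ENNReal.ofReal (P x y) • Measure.dirac y

lemma stepLaw_singleton (P : Matrix S S ℝ) (x y : S) :
    stepLaw P x {y} = ENNReal.ofReal (P x y) := by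
  simp only [stepLaw, Measure.finsetSum_apply, Measure.smul_apply, smul_eq_mul,
    Measure.dirac_apply, Set.indicator_apply, Set.mem_singleton_iff]
  simp

lemma stepLaw_prob (P : Matrix S S ℝ) (hP : RowStochastic P) (x : S) :
    IsProbabilityMeasure (stepLaw P x) := by
  constructor
  simp only [stepLaw, Measure.finsetSum_apply, Measure.smul_apply, smul_eq_mul, measure_univ,
    mul_one]
  rw [← ENNReal.ofReal_sum_of_nonneg (fun y _ => hP.1 x y), hP.2, ENNReal.ofReal_one]

/-- path driven by noise -/
def drive (x0 : S) (ω : ℕ × S → S) : ℕ → S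
  | 0 => x0
  | t + 1 => ω (t, drive x0 ω t)

lemma drive_measurable (x0 : S) : Measurable (drive x0 : (ℕ × S → S) → ℕ → S) := by
  refine measurable_pi_lambda _ fun t => ?_
  induction t with
  | zero => simp only [drive]; exact measurable_const
  | succ t ih =>
    refine measurable_to_countable' fun y => ?_
    have : (fun ω => drive x0 ω (t + 1)) ⁻¹' {y}
        = ⋃ x : S, ((fun ω => drive x0 ω t) ⁻¹' {x} ∩ (fun ω => ω (t, x)) ⁻¹' {y}) := by
      ext ω
      simp [drive]
    rw [this]
    exact MeasurableSet.iUnion fun x => (ih (measurableSet_singleton x)).inter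
      ((measurable_pi_apply (t, x)) (measurableSet_singleton y))

lemma exists_traj (P : Matrix S S ℝ) (hP : RowStochastic P) (x0 : S) :
    ∃ μ : Measure (ℕ → S), IsProbabilityMeasure μ ∧ GenTraj μ P := by
  haveI : ∀ p : ℕ × S, IsProbabilityMeasure (stepLaw P p.2) := fun p => stepLaw_prob P hP p.2
  let ν : Measure (ℕ × S → S) := Measure.infinitePi fun p : ℕ × S => stepLaw P p.2
  have hm := drive_measurable x0
  refine ⟨ν.map (drive x0), Measure.isProbabilityMeasure_map hm.aemeasurable, ?_⟩
  have hms : ∀ (t : ℕ) (f : ℕ → S), MeasurableSet {ω : ℕ → S | ∀ s ≤ t, ω s = f s} := by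
    intro t f
    have : {ω : ℕ → S | ∀ s ≤ t, ω s = f s}
        = ⋂ s, ⋂ (_ : s ≤ t), (fun ω : ℕ → S => ω s) ⁻¹' {f s} := by
      ext ω; simp
    rw [this]
    exact MeasurableSet.iInter fun s => MeasurableSet.iInter fun _ =>
      (measurable_pi_apply s) (measurableSet_singleton _)
  have key : ∀ (t : ℕ) (f : ℕ → S), f 0 = x0 →
      (ν.map (drive x0) {ω | ∀ s ≤ t, ω s = f s}).toReal
        = ∏ s ∈ Finset.range t, P (f s) (f (s + 1)) := by
    intro t f hf
    rw [Measure.map_apply hm (hms t f)]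
    have e : drive x0 ⁻¹' {ω | ∀ s ≤ t, ω s = f s}
        = Set.pi (((Finset.range t).image fun s => (s, f s) : Finset (ℕ × S)) : Set (ℕ × S))
          (fun p => {f (p.1 + 1)}) := by
      ext ω
      simp only [Set.mem_preimage, Set.mem_ofPred_eq, Set.mem_pi, Finset.mem_coe,
        Finset.mem_image, Finset.mem_range, Set.mem_singleton_iff]
      constructor
      · rintro a _ ⟨s, hs, rfl⟩
        have h1 := a (s + 1) (by omega)
        rw [drive, a s (by omega)] at h1
        exact h1
      · intro a s
        induction s with
        | zero => intro _; rw [drive, hf]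
        | succ s ih =>
          intro hs
          rw [drive, ih (by omega)]
          exact a (s, f s) ⟨s, by omega, rfl⟩
    rw [e, Measure.infinitePi_pi _ (fun _ _ => measurableSet_singleton _),
      Finset.prod_image (fun a _ b _ hab => (Prod.mk.inj hab).1), ENNReal.toReal_prod]
    refine Finset.prod_congr rfl fun s _ => ?_
    rw [stepLaw_singleton, ENNReal.toReal_ofReal (hP.1 _ _)]
  intro t f
  by_cases hf : f 0 = x0
  · rw [key _ f hf, key _ f hf, Finset.prod_range_succ]
  · have : ∀ t, ν.map (drive x0) {ω | ∀ s ≤ t, ω s = f s} = 0 := by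
      intro t
      rw [Measure.map_apply hm (hms t f)]
      have : drive x0 ⁻¹' {ω | ∀ s ≤ t, ω s = f s} = ∅ := by
        ext ω
        simp only [Set.mem_preimage, Set.mem_ofPred_eq, Set.mem_empty_iff_false, iff_false]
        intro a
        exact hf (a 0 (Nat.zero_le _)).symm
      rw [this, measure_empty]
    rw [this, this]; simp

end Existence

section Local

lemma mem_nbhd_self {N nv : ℕ} (n : Fin N) : n ∈ nbhd N nv n := by
  simp [nbhd]

lemma pcaP_pos {N K nv : ℕ} {T : Matrix (Fin K) (Fin K) ℝ} (hT : RowStochastic T)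
    (x y : Fin N → Fin K) :
    0 < pcaP N K nv T x y ↔ ∀ n, ∃ i ∈ nbhd N nv n, 0 < T (x i) (y n) := by
  have hc : ∀ n : Fin N, (0 : ℝ) < ((nbhd N nv n).card : ℝ)⁻¹ := fun n =>
    inv_pos.2 (Nat.cast_pos.2 (Finset.card_pos.2 ⟨n, mem_nbhd_self n⟩))
  have hnn : ∀ n : Fin N, 0 ≤ ((nbhd N nv n).card : ℝ)⁻¹ * ∑ i ∈ nbhd N nv n, T (x i) (y n) :=
    fun n => mul_nonneg (hc n).le (Finset.sum_nonneg fun i _ => hT.1 _ _)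
  simp only [pcaP, Matrix.of_apply]
  constructor
  · intro h n
    have h1 := Finset.prod_ne_zero_iff.1 h.ne' n (Finset.mem_univ n)
    by_contra! hcon
    exact h1 (by rw [Finset.sum_eq_zero fun i hi => le_antisymm (hcon i hi) (hT.1 _ _), mul_zero])
  · intro h
    refine Finset.prod_pos fun n _ => mul_pos (hc n) ?_
    obtain ⟨i, hi, hp⟩ := h n
    exact Finset.sum_pos' (fun i _ => hT.1 _ _) ⟨i, hi, hp⟩

lemma pcaP_stoch {N K nv : ℕ} {T : Matrix (Fin K) (Fin K) ℝ} (hT : RowStochastic T) :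
    RowStochastic (pcaP N K nv T) := by
  constructor
  · intro x y
    simp only [pcaP, Matrix.of_apply]
    exact Finset.prod_nonneg fun n _ => mul_nonneg (inv_nonneg.2 (Nat.cast_nonneg _))
      (Finset.sum_nonneg fun i _ => hT.1 _ _)
  · intro x
    simp only [pcaP, Matrix.of_apply]
    rw [← Fintype.prod_sum (fun (n : Fin N) (k : Fin K) =>
      ((nbhd N nv n).card : ℝ)⁻¹ * ∑ i ∈ nbhd N nv n, T (x i) k)]
    refine Finset.prod_eq_one fun n _ => ?_
    rw [← Finset.mul_sum, Finset.sum_comm]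
    simp only [hT.2]
    have : ((nbhd N nv n).card : ℝ) ≠ 0 :=
      Nat.cast_ne_zero.2 (Finset.card_pos.2 ⟨n, mem_nbhd_self n⟩).ne'
    simp [this]

lemma pow_nn {K : ℕ} {T : Matrix (Fin K) (Fin K) ℝ} (hT : RowStochastic T) (m : ℕ) (i j) :
    0 ≤ (T ^ m) i j := by
  induction m generalizing i j with
  | zero => rw [pow_zero, Matrix.one_apply]; split_ifs <;> norm_num
  | succ m ih =>
    rw [pow_succ, Matrix.mul_apply]
    exact Finset.sum_nonneg fun k _ => mul_nonneg (ih _ _) (hT.1 _ _)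

lemma pow_add_pos {K : ℕ} {T : Matrix (Fin K) (Fin K) ℝ} (hT : RowStochastic T) {m n : ℕ} {i j k}
    (h1 : 0 < (T ^ m) i j) (h2 : 0 < (T ^ n) j k) : 0 < (T ^ (m + n)) i k := by
  rw [pow_add, Matrix.mul_apply]
  exact Finset.sum_pos' (fun l _ => mul_nonneg (pow_nn hT _ _ _) (pow_nn hT _ _ _))
    ⟨j, Finset.mem_univ j, mul_pos h1 h2⟩

lemma pow_succ_pos_iff {K : ℕ} {T : Matrix (Fin K) (Fin K) ℝ} (hT : RowStochastic T) (m : ℕ) (i k) :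
    0 < (T ^ (m + 1)) i k ↔ ∃ j, 0 < (T ^ m) i j ∧ 0 < T j k := by
  constructor
  · intro h
    by_contra! hcon
    rw [pow_succ, Matrix.mul_apply] at h
    refine h.ne' (Finset.sum_eq_zero fun j _ => ?_)
    rcases (pow_nn hT m i j).eq_or_lt with h0 | h0
    · rw [← h0, zero_mul]
    · rw [le_antisymm (hcon j h0) (hT.1 _ _), mul_zero]
  · rintro ⟨j, h1, h2⟩
    exact pow_add_pos hT h1 (by simpa using h2)

lemma pow_reach {K : ℕ} {T : Matrix (Fin K) (Fin K) ℝ} (hT : RowStochastic T) (m : ℕ) (i k)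
    (h : 0 < (T ^ m) i k) : Relation.ReflTransGen (fun a b => 0 < T a b) i k := by
  induction m generalizing k with
  | zero =>
    rw [pow_zero, Matrix.one_apply] at h
    split_ifs at h with e
    · rw [e]
    · exact absurd h (lt_irrefl _)
  | succ m ih =>
    obtain ⟨j, h1, h2⟩ := (pow_succ_pos_iff hT m i k).1 h
    exact (ih j h1).tail h2

lemma exists_succ {K : ℕ} {T : Matrix (Fin K) (Fin K) ℝ} (hT : RowStochastic T) (i : Fin K) :
    ∃ j, 0 < T i j := by
  by_contra! h
  have := hT.2 i
  rw [Finset.sum_eq_zero fun j _ => le_antisymm (h j) (hT.1 i j)] at this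
  exact zero_ne_one this

/-- period `K` makes the transitions deterministic -/
lemma det_of_period {K : ℕ} (hK : 0 < K) {T : Matrix (Fin K) (Fin K) ℝ} (hT : RowStochastic T)
    (hirr : MatIrreducible T) (hper : ∀ i, IsGcdPeriod T i K) (j k k' : Fin K)
    (h1 : 0 < T j k) (h2 : 0 < T j k') : k = k' := by
  haveI : NeZero K := ⟨hK.ne'⟩
  let i0 : Fin K := ⟨0, hK⟩
  have hret : ∀ i m, 0 < (T ^ m) i i → ((m : ℕ) : ZMod K) = 0 := by
    intro i m hm
    rw [ZMod.natCast_eq_zero_iff]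
    rcases Nat.eq_zero_or_pos m with rfl | h
    · exact dvd_zero _
    · exact (hper i).1 m h hm
  choose c hc using fun x => hirr i0 x
  have huniq : ∀ (x : Fin K) (m : ℕ), 0 < (T ^ m) i0 x → (m : ZMod K) = c x := by
    intro x m hm
    obtain ⟨b, hb⟩ := hirr x i0
    have e1 := hret i0 _ (pow_add_pos hT hm hb)
    have e2 := hret i0 _ (pow_add_pos hT (hc x) hb)
    push_cast at e1 e2
    exact add_right_cancel (e1.trans e2.symm)
  have hsurj : Function.Surjective fun x : Fin K => (c x : ZMod K) := by
    have hall : ∀ m : ℕ, ∃ x, 0 < (T ^ m) i0 x := by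
      intro m
      induction m with
      | zero => exact ⟨i0, by simp⟩
      | succ m ih =>
        obtain ⟨x, hx⟩ := ih
        obtain ⟨y, hy⟩ := exists_succ hT x
        exact ⟨y, (pow_succ_pos_iff hT _ _ _).2 ⟨x, hx, hy⟩⟩
    intro z
    obtain ⟨x, hx⟩ := hall z.val
    refine ⟨x, ?_⟩
    simp only
    rw [← huniq x _ hx, ZMod.natCast_zmod_val]
  have hbij := (Fintype.bijective_iff_surjective_and_card _).2
    ⟨hsurj, by rw [Fintype.card_fin, ZMod.card]⟩
  apply hbij.1
  simp only
  rw [← huniq k (c j + 1) ((pow_succ_pos_iff hT _ _ _).2 ⟨j, hc j, h1⟩),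
    ← huniq k' (c j + 1) ((pow_succ_pos_iff hT _ _ _).2 ⟨j, hc j, h2⟩)]

lemma period_of_det {K : ℕ} {T : Matrix (Fin K) (Fin K) ℝ} (hT : RowStochastic T)
    (hirr : MatIrreducible T) (hdet : ∀ j k k' : Fin K, 0 < T j k → 0 < T j k' → k = k')
    (i : Fin K) : IsGcdPeriod T i K := by
  choose σ hσ using fun j => exists_succ hT j
  have hpow : ∀ m j, 0 < (T ^ m) i j ↔ σ^[m] i = j := by
    intro m
    induction m with
    | zero =>
      intro j
      rw [pow_zero, Matrix.one_apply, Function.iterate_zero, id]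
      split_ifs with e <;> simp [e]
    | succ m ih =>
      intro j
      rw [pow_succ_pos_iff hT, Function.iterate_succ_apply']
      constructor
      · rintro ⟨k, h1, h2⟩
        rw [(ih k).1 h1]
        exact hdet k _ _ (hσ k) h2
      · intro e
        exact ⟨_, (ih _).2 rfl, e ▸ hσ _⟩
  obtain ⟨t, ht⟩ := hirr (σ i) i
  have hp : 0 < (T ^ (1 + t)) i i := pow_add_pos hT (by simpa using hσ i) ht
  have hper : i ∈ Function.periodicPts σ := ⟨1 + t, by omega, (hpow _ _).1 hp⟩
  have hpos := Function.minimalPeriod_pos_of_mem_periodicPts hper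
  have hcard : Function.minimalPeriod σ i = K := by
    have e : (Finset.range (Function.minimalPeriod σ i)).image (fun r => σ^[r] i)
        = Finset.univ := by
      ext j
      simp only [Finset.mem_image, Finset.mem_range, Finset.mem_univ, iff_true]
      obtain ⟨m, hm⟩ := hirr i j
      exact ⟨m % Function.minimalPeriod σ i, Nat.mod_lt _ hpos,
        Function.iterate_mod_minimalPeriod_eq.trans ((hpow _ _).1 hm)⟩
    have := congrArg Finset.card e
    rw [Finset.card_image_of_injOn, Finset.card_range, Finset.card_univ, Fintype.card_fin] at this
    · exact this
    · intro a ha b hb hab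
      exact Function.iterate_injOn_Iio_minimalPeriod (by simpa using ha) (by simpa using hb) hab
  constructor
  · intro m _ hm
    have : Function.IsPeriodicPt σ m i := (hpow _ _).1 hm
    exact hcard ▸ this.minimalPeriod_dvd
  · intro e he
    refine he K (hcard ▸ hpos) ((hpow _ _).2 ?_)
    have := Function.isPeriodicPt_minimalPeriod σ i
    rw [hcard] at this
    exact this

end Local

/-- For an irreducible local transition matrix `T`, the PCA on the `N`-cycle
achieves synchronization almost surely (for every law of the chain, with probability one
there is a finite time `t₀` after which all sites agree) if and only if `T` is periodic
with period `K`. -/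
theorem stmt_4 {K N nv : ℕ} (hK : 0 < K) (hN : 2 ≤ N) (hnv : 0 < nv)
    (T : Matrix (Fin K) (Fin K) ℝ) (hT : RowStochastic T) (hirr : MatIrreducible T) :
    (∀ μ : Measure (ℕ → Fin N → Fin K), IsProbabilityMeasure μ →
        IsPCATrajectory μ (pcaP N K nv T) →
        μ {ω | ∃ t₀ : ℕ, ∀ t ≥ t₀, ∀ n m : Fin N, ω t n = ω t m} = 1)
      ↔ ∀ i, IsGcdPeriod T i K := by
  classical
  let n0 : Fin N := ⟨0, by omega⟩
  let n1 : Fin N := ⟨1, by omega⟩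
  constructor
  · intro hsync
    apply period_of_det hT hirr
    intro j k k' hk hk'
    by_contra hne
    obtain ⟨μ, hμ, htr⟩ := exists_traj (pcaP N K nv T) (pcaP_stoch hT) (fun _ => ⟨0, hK⟩)
    have hs := hsync μ hμ htr
    have hesc := escape μ _ htr (pcaP_stoch hT)
      (Finset.univ.filter fun x : Fin N → Fin K => ∀ n m, x n = x m) (by
        intro x hx
        rw [Finset.mem_filter] at hx
        have hxc : x = fun _ => x n0 := funext fun n => hx.2 n n0
        refine ⟨fun n => if n = n0 then k else k', ?_, ?_⟩
        · rw [Finset.mem_filter]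
          rintro ⟨-, h⟩
          have := h n0 n1
          have h10 : n1 ≠ n0 := by simp [n0, n1]
          simp only [if_true, h10, if_false] at this
          exact hne this
        · obtain ⟨m, hm⟩ := hirr (x n0) j
          have h1 := pow_reach hT m _ _ hm
          have h2 : Relation.ReflTransGen (fun a b => 0 < pcaP N K nv T a b)
              (fun _ => x n0) (fun _ => j) :=
            Relation.ReflTransGen.lift (r := fun a b => 0 < T a b)
              (p := fun a b => 0 < pcaP N K nv T a b) (fun (a : Fin K) => (fun _ : Fin N => a))
              (fun a b hab => (pcaP_pos hT _ _).2 fun n => ⟨n, mem_nbhd_self n, hab⟩) _ _ h1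
          rw [hxc]
          refine h2.tail ((pcaP_pos hT _ _).2 fun n => ⟨n, mem_nbhd_self n, ?_⟩)
          split_ifs
          · exact hk
          · exact hk')
    have hz : μ {ω | ∃ t₀ : ℕ, ∀ t ≥ t₀, ∀ n m : Fin N, ω t n = ω t m} = 0 := by
      rw [ae_iff] at hesc
      refine measure_mono_null ?_ hesc
      rintro ω ⟨t₀, h⟩ hcon
      obtain ⟨t, ht, hb⟩ := hcon t₀
      exact hb (Finset.mem_filter.2 ⟨Finset.mem_univ _, h t ht⟩)
    rw [hz] at hs
    exact zero_ne_one hs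
  · intro hper μ hμ htr
    have hdet := det_of_period hK hT hirr hper
    choose σ hσ using fun j => exists_succ hT j
    have hpos := ae_pos μ _ htr
    have hesc := escape μ _ htr (pcaP_stoch hT)
      (Finset.univ.filter fun x : Fin N → Fin K => ¬ ∀ n m, x n = x m) (by
        intro x _
        let y : ℕ → Fin N → Fin K := fun s n => σ^[s] (x ⟨n.1 - s, by omega⟩)
        refine ⟨y N, ?_, ?_⟩
        · rw [Finset.mem_filter, not_and, not_not]
          intro _ n m
          simp only [y]
          congr 3
          omega
        · have h : ∀ s, Relation.ReflTransGen (fun a b => 0 < pcaP N K nv T a b) x (y s) := by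
            intro s
            induction s with
            | zero => exact Relation.ReflTransGen.refl
            | succ s ih =>
              refine ih.tail ((pcaP_pos hT _ _).2 fun n => ?_)
              have hstep : ∀ i : Fin N, i.1 - s = n.1 - (s + 1) →
                  0 < T (y s i) (y (s + 1) n) := by
                intro i hi
                simp only [y, Function.iterate_succ_apply', hi]
                exact hσ _
              rcases Nat.eq_zero_or_pos n.1 with h0 | h0
              · exact ⟨n, mem_nbhd_self n, hstep n (by omega)⟩
              · refine ⟨⟨n.1 - 1, by omega⟩, ?_, hstep _ (by simp only; omega)⟩
                simp only [nbhd, Finset.mem_filter, Finset.mem_univ, true_and]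
                left
                rw [show n.1 + N - (n.1 - 1) = N + 1 by omega, Nat.add_mod_left,
                  Nat.mod_eq_of_lt (by omega)]
                omega
          exact h N)
    have : ∀ᵐ ω ∂μ, ω ∈ {ω : ℕ → Fin N → Fin K |
        ∃ t₀ : ℕ, ∀ t ≥ t₀, ∀ n m : Fin N, ω t n = ω t m} := by
      filter_upwards [hpos, hesc] with ω hp he
      obtain ⟨t₀, -, h0⟩ := he 0
      rw [Finset.mem_filter, not_and, not_not] at h0
      refine ⟨t₀, fun t ht => ?_⟩
      induction t, ht using Nat.le_induction with
      | base => exact h0 (Finset.mem_univ _)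
      | succ t _ ih =>
        have hlt := lt_of_le_of_ne ((pcaP_stoch hT).1 _ _) (hp t).symm
        rw [pcaP_pos hT] at hlt
        intro n m
        obtain ⟨i, _, hi⟩ := hlt n
        obtain ⟨i', _, hi'⟩ := hlt m
        rw [ih i' i] at hi'
        exact hdet _ _ _ hi hi'
    exact (measure_congr (Filter.eventuallyEq_univ.2 this)).trans measure_univ
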